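/- Let L>0, M<0 and T>(1+√2)L/|M|. Assume hypothesis (H): for every δ>0 there exist constants C_δ>0 and T_δ>0 such that for every S∈(0,T_δ) and every Dirichlet heat solution φ on [0,∞) (with all integrals below finite): ∫_0^∞∫_0^L e^{-L²/(2t)} φ(t,x)² dx dt ≤ C_δ e^{δ/S} ∫_0^S (∂_xφ(t,0))² dt. Then there exist constants C>0 and K>0 (independent of ε) such that for every ε∈(0,1) and every adjoint transport-diffusion solution ψ (with all integrals finite): ∫_0^L ψ(T,x)² dx ≤ C·e^{-2K/ε}·∫_0^T (∂_xψ(t,0))² dt. -/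

import Mathlib

open MeasureTheory

/-- A "Dirichlet heat solution on `[0,∞)`" for the interval `[0,L]`:
`φ : [0,∞) × [0,L] → ℝ` continuous, `C¹` in `t` and `C²` in `x` on `(0,∞) × [0,L]`,
satisfying `∂_t φ = ∂_{xx} φ` for `t > 0`, `x ∈ (0,L)`, with homogeneous Dirichlet
boundary conditions.  The derivatives are given by the data `φt`, `φx`, `φxx`. -/
structure IsDirichletHeatSol (L : ℝ) (φ φt φx φxx : ℝ → ℝ → ℝ) : Prop where
  cont : ContinuousOn (fun p : ℝ × ℝ => φ p.1 p.2) (Set.Ici 0 ×ˢ Set.Icc 0 L)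
  ht : ∀ t > (0 : ℝ), ∀ x ∈ Set.Icc (0 : ℝ) L,
    HasDerivAt (fun τ => φ τ x) (φt t x) t
  htc : ∀ x ∈ Set.Icc (0 : ℝ) L, ContinuousOn (fun t => φt t x) (Set.Ioi 0)
  hx : ∀ t > (0 : ℝ), ∀ x ∈ Set.Icc (0 : ℝ) L,
    HasDerivWithinAt (fun ξ => φ t ξ) (φx t x) (Set.Icc 0 L) x
  hxc : ∀ t > (0 : ℝ), ContinuousOn (fun x => φx t x) (Set.Icc 0 L)
  hxx : ∀ t > (0 : ℝ), ∀ x ∈ Set.Icc (0 : ℝ) L,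
    HasDerivWithinAt (fun ξ => φx t ξ) (φxx t x) (Set.Icc 0 L) x
  hxxc : ∀ t > (0 : ℝ), ContinuousOn (fun x => φxx t x) (Set.Icc 0 L)
  pde : ∀ t > (0 : ℝ), ∀ x ∈ Set.Ioo (0 : ℝ) L, φt t x = φxx t x
  bc0 : ∀ t ≥ (0 : ℝ), φ t 0 = 0
  bcL : ∀ t ≥ (0 : ℝ), φ t L = 0

/-- An "adjoint transport-diffusion solution" for parameters `L, M, ε`:
`ψ : [0,∞) × [0,L] → ℝ` continuous, `C¹` in `t` and `C²` in `x` on `(0,∞) × [0,L]`,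
with `∂_t ψ - ε ∂_{xx} ψ - M ∂_x ψ = 0` for `t > 0`, `x ∈ (0,L)`, and
`ψ(t,0) = ψ(t,L) = 0` for all `t ≥ 0`.  The derivatives are the data `ψt`, `ψx`, `ψxx`. -/
structure IsAdjointTDSol (L M ε : ℝ) (ψ ψt ψx ψxx : ℝ → ℝ → ℝ) : Prop where
  cont : ContinuousOn (fun p : ℝ × ℝ => ψ p.1 p.2) (Set.Ici 0 ×ˢ Set.Icc 0 L)
  ht : ∀ t > (0 : ℝ), ∀ x ∈ Set.Icc (0 : ℝ) L,
    HasDerivAt (fun τ => ψ τ x) (ψt t x) t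
  htc : ∀ x ∈ Set.Icc (0 : ℝ) L, ContinuousOn (fun t => ψt t x) (Set.Ioi 0)
  hx : ∀ t > (0 : ℝ), ∀ x ∈ Set.Icc (0 : ℝ) L,
    HasDerivWithinAt (fun ξ => ψ t ξ) (ψx t x) (Set.Icc 0 L) x
  hxc : ∀ t > (0 : ℝ), ContinuousOn (fun x => ψx t x) (Set.Icc 0 L)
  hxx : ∀ t > (0 : ℝ), ∀ x ∈ Set.Icc (0 : ℝ) L,
    HasDerivWithinAt (fun ξ => ψx t ξ) (ψxx t x) (Set.Icc 0 L) x
  hxxc : ∀ t > (0 : ℝ), ContinuousOn (fun x => ψxx t x) (Set.Icc 0 L)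
  pde : ∀ t > (0 : ℝ), ∀ x ∈ Set.Ioo (0 : ℝ) L,
    ψt t x - ε * ψxx t x - M * ψx t x = 0
  bc0 : ∀ t ≥ (0 : ℝ), ψ t 0 = 0
  bcL : ∀ t ≥ (0 : ℝ), ψ t L = 0

theorem IsLocalMax.second_deriv_nonpos {f f' : ℝ → ℝ} {x c : ℝ} (hmax : IsLocalMax f x)
    (hf : ∀ᶠ y in nhds x, HasDerivAt f (f' y) y) (hf' : HasDerivAt f' c x) : c ≤ 0 := by
  by_contra! hc
  have hd : deriv f =ᶠ[nhds x] f' := hf.mono fun y hy => hy.deriv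
  have hdd : deriv (deriv f) x = c := by rw [hd.deriv_eq, hf'.deriv]
  have hmin : IsLocalMin f x :=
    isLocalMin_of_deriv_deriv_pos (hdd ▸ hc) hmax.deriv_eq_zero hf.self_of_nhds.continuousAt
  have hconst : f =ᶠ[nhds x] fun _ => f x := by
    filter_upwards [hmax, hmin] with y h1 h2 using le_antisymm h1 h2
  have h0 : deriv (deriv f) x = 0 := by
    rw [hconst.deriv.deriv_eq]; simp
  linarith

/-- Weak maximum principle for the heat operator, under pointwise differentiability only. -/
theorem nonpos_of_heat_subsolution {L a b : ℝ} {w wt wx wxx : ℝ → ℝ → ℝ}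
    (hc : ContinuousOn (fun p : ℝ × ℝ => w p.1 p.2) (Set.Icc a b ×ˢ Set.Icc 0 L))
    (ht : ∀ t ∈ Set.Ioc a b, ∀ x ∈ Set.Ioo 0 L, HasDerivAt (fun τ => w τ x) (wt t x) t)
    (hx : ∀ t ∈ Set.Ioc a b, ∀ x ∈ Set.Ioo 0 L, HasDerivAt (fun ξ => w t ξ) (wx t x) x)
    (hxx : ∀ t ∈ Set.Ioc a b, ∀ x ∈ Set.Ioo 0 L, HasDerivAt (fun ξ => wx t ξ) (wxx t x) x)
    (hsub : ∀ t ∈ Set.Ioc a b, ∀ x ∈ Set.Ioo 0 L, wt t x ≤ wxx t x)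
    (hinit : ∀ x ∈ Set.Icc 0 L, w a x ≤ 0)
    (h0 : ∀ t ∈ Set.Icc a b, w t 0 ≤ 0) (hL : ∀ t ∈ Set.Icc a b, w t L ≤ 0) :
    ∀ t ∈ Set.Icc a b, ∀ x ∈ Set.Icc 0 L, w t x ≤ 0 := by
  intro t₁ ht₁ x₁ hx₁
  by_contra! hpos
  obtain ⟨κ, hκ, hκw⟩ : ∃ κ > 0, 0 < w t₁ x₁ - κ * (t₁ - a) := by
    have hd : 0 ≤ t₁ - a := sub_nonneg.2 ht₁.1
    refine ⟨w t₁ x₁ / (t₁ - a + 1), by positivity, ?_⟩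
    rw [sub_pos, div_mul_eq_mul_div, div_lt_iff₀ (by positivity)]
    nlinarith
  have hc' : ContinuousOn (fun p : ℝ × ℝ => w p.1 p.2 - κ * (p.1 - a))
      (Set.Icc a b ×ˢ Set.Icc 0 L) := hc.sub (by fun_prop)
  obtain ⟨⟨t, x⟩, ⟨htm, hxm⟩, hmax⟩ :=
    (isCompact_Icc.prod isCompact_Icc).exists_isMaxOn ⟨(t₁, x₁), ht₁, hx₁⟩ hc'
  have hM : ∀ s ∈ Set.Icc a b, ∀ y ∈ Set.Icc 0 L,
      w s y - κ * (s - a) ≤ w t x - κ * (t - a) := fun s hs y hy =>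
    hmax (Set.mk_mem_prod hs hy)
  simp only at htm hxm
  have hwpos : 0 < w t x - κ * (t - a) := hκw.trans_le (hM t₁ ht₁ x₁ hx₁)
  have hwpos' : 0 < w t x := by nlinarith [htm.1]
  have hta : t ∈ Set.Ioc a b := by
    refine ⟨lt_of_le_of_ne htm.1 ?_, htm.2⟩
    rintro rfl
    exact absurd (hinit x hxm) (not_le.2 hwpos')
  have hxI : x ∈ Set.Ioo 0 L := by
    refine ⟨lt_of_le_of_ne hxm.1 ?_, lt_of_le_of_ne hxm.2 ?_⟩
    · rintro rfl
      exact absurd (h0 t htm) (not_le.2 hwpos')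
    · rintro rfl
      exact absurd (hL t htm) (not_le.2 hwpos')
  have hnhds : Set.Ioo 0 L ∈ nhds x := isOpen_Ioo.mem_nhds hxI
  have hlm : IsLocalMax (fun ξ => w t ξ) x := by
    filter_upwards [hnhds] with y hy
    have := hM t htm y (Set.Ioo_subset_Icc_self hy)
    linarith
  have hxx0 : wxx t x ≤ 0 :=
    hlm.second_deriv_nonpos (Filter.mem_of_superset hnhds fun y hy => hx t hta y hy)
      (hxx t hta x hxI)
  have htκ : κ ≤ wt t x := by
    have hd := ((ht t hta x hxI).sub (((hasDerivAt_id t).sub_const a).const_mul κ)).hasDerivWithinAt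
      (s := Set.Iio t)
    rw [hasDerivWithinAt_iff_tendsto_slope' (by simp)] at hd
    have := ge_of_tendsto hd (b := 0) (by
      filter_upwards [Ioo_mem_nhdsLT hta.1] with s hs
      rw [slope_def_field]
      apply div_nonneg_of_nonpos
      · have := hM s ⟨hs.1.le, hs.2.le.trans hta.2⟩ x hxm
        simp only [Pi.sub_apply, id]
        linarith
      · linarith [hs.2])
    linarith
  linarith [hsub t hta x hxI]

namespace IsDirichletHeatSol

variable {L : ℝ} {φ φt φx φxx : ℝ → ℝ → ℝ}

theorem neg (h : IsDirichletHeatSol L φ φt φx φxx) :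
    IsDirichletHeatSol L (fun t x => -φ t x) (fun t x => -φt t x) (fun t x => -φx t x)
      (fun t x => -φxx t x) where
  cont := h.cont.neg
  ht t ht x hx := (h.ht t ht x hx).neg
  htc x hx := (h.htc x hx).neg
  hx t ht x hx := (h.hx t ht x hx).neg
  hxc t ht := (h.hxc t ht).neg
  hxx t ht x hx := (h.hxx t ht x hx).neg
  hxxc t ht := (h.hxxc t ht).neg
  pde t ht x hx := congrArg Neg.neg (h.pde t ht x hx)
  bc0 t ht := by rw [h.bc0 t ht, neg_zero]
  bcL t ht := by rw [h.bcL t ht, neg_zero]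

theorem continuousOn_slice (h : IsDirichletHeatSol L φ φt φx φxx) {t : ℝ} (ht : 0 ≤ t) :
    ContinuousOn (φ t) (Set.Icc 0 L) :=
  h.cont.comp (f := fun x => (t, x)) (by fun_prop) fun _ hx => ⟨ht, hx⟩

theorem hasDerivAt_x (h : IsDirichletHeatSol L φ φt φx φxx) {t x : ℝ} (ht : 0 < t)
    (hx : x ∈ Set.Ioo 0 L) : HasDerivAt (fun ξ => φ t ξ) (φx t x) x :=
  (h.hx t ht x (Set.Ioo_subset_Icc_self hx)).hasDerivAt (Icc_mem_nhds hx.1 hx.2)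

theorem hasDerivAt_xx (h : IsDirichletHeatSol L φ φt φx φxx) {t x : ℝ} (ht : 0 < t)
    (hx : x ∈ Set.Ioo 0 L) : HasDerivAt (fun ξ => φx t ξ) (φxx t x) x :=
  (h.hxx t ht x (Set.Ioo_subset_Icc_self hx)).hasDerivAt (Icc_mem_nhds hx.1 hx.2)

theorem sub_le_mul (h : IsDirichletHeatSol L φ φt φx φxx) {s t x K : ℝ} (hs : 0 < s)
    (hK0 : 0 ≤ K) (hK : ∀ y ∈ Set.Icc 0 L, φxx s y ≤ K) (hst : s ≤ t)
    (hx : x ∈ Set.Icc 0 L) : φ t x - φ s x ≤ K * (t - s) := by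
  have key := nonpos_of_heat_subsolution (L := L) (a := s) (b := t)
    (w := fun τ ξ => φ τ ξ - φ s ξ - K * (τ - s)) (wt := fun τ ξ => φt τ ξ - K)
    (wx := fun τ ξ => φx τ ξ - φx s ξ) (wxx := fun τ ξ => φxx τ ξ - φxx s ξ)
    (by
      have h1 : ContinuousOn (fun p : ℝ × ℝ => φ p.1 p.2) (Set.Icc s t ×ˢ Set.Icc 0 L) :=
        h.cont.mono (Set.prod_mono (fun τ hτ => hs.le.trans hτ.1) le_rfl)
      have h2 : ContinuousOn (fun p : ℝ × ℝ => φ s p.2) (Set.Icc s t ×ˢ Set.Icc 0 L) :=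
        (h.continuousOn_slice hs.le).comp continuousOn_snd fun p hp => hp.2
      exact (h1.sub h2).sub (by fun_prop))
    (fun τ hτ ξ hξ => by
      have := ((h.ht τ (hs.trans hτ.1) ξ (Set.Ioo_subset_Icc_self hξ)).sub_const (φ s ξ)).sub
        (((hasDerivAt_id τ).sub_const s).const_mul K)
      rw [mul_one] at this
      exact this)
    (fun τ hτ ξ hξ => ((h.hasDerivAt_x (hs.trans hτ.1) hξ).sub
      (h.hasDerivAt_x hs hξ)).sub_const _)
    (fun τ hτ ξ hξ => (h.hasDerivAt_xx (hs.trans hτ.1) hξ).sub (h.hasDerivAt_xx hs hξ))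
    (fun τ hτ ξ hξ => by
      have h1 := h.pde τ (hs.trans hτ.1) ξ hξ
      have h2 := hK ξ (Set.Ioo_subset_Icc_self hξ)
      linarith)
    (fun ξ _ => by simp)
    (fun τ hτ => by
      have := mul_nonneg hK0 (sub_nonneg.2 hτ.1)
      simp only [h.bc0 τ (hs.le.trans hτ.1), h.bc0 s hs.le]; linarith)
    (fun τ hτ => by
      have := mul_nonneg hK0 (sub_nonneg.2 hτ.1)
      simp only [h.bcL τ (hs.le.trans hτ.1), h.bcL s hs.le]; linarith)
    t ⟨hst, le_rfl⟩ x hx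
  linarith

theorem exists_abs_sub_le (h : IsDirichletHeatSol L φ φt φx φxx) {s : ℝ} (hs : 0 < s) :
    ∃ K, ∀ t ≥ s, ∀ x ∈ Set.Icc 0 L, |φ t x - φ s x| ≤ K * (t - s) := by
  obtain ⟨K, hK⟩ := isCompact_Icc.exists_bound_of_continuousOn (h.hxxc s hs)
  have hK' : ∀ y ∈ Set.Icc 0 L, |φxx s y| ≤ max K 0 := fun y hy => (hK y hy).trans (le_max_left _ _)
  refine ⟨max K 0, fun t ht x hx => abs_le.2 ⟨?_, ?_⟩⟩
  · have := h.neg.sub_le_mul hs (le_max_right K 0)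
      (fun y hy => (neg_le_abs _).trans (hK' y hy)) ht hx
    linarith
  · exact h.sub_le_mul hs (le_max_right K 0) (fun y hy => (le_abs_self _).trans (hK' y hy)) ht hx

theorem integral_mul_xx_nonpos (h : IsDirichletHeatSol L φ φt φx φxx) (hL : 0 ≤ L) {t : ℝ}
    (ht : 0 < t) : ∫ x in (0 : ℝ)..L, φ t x * φxx t x ≤ 0 := by
  have c0 := h.continuousOn_slice ht.le
  have c1 := h.hxc t ht
  have c2 := h.hxxc t ht
  have i1 : IntervalIntegrable (fun x => φx t x * φx t x) volume 0 L :=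
    (c1.mul c1).intervalIntegrable_of_Icc hL
  have i2 : IntervalIntegrable (fun x => φ t x * φxx t x) volume 0 L :=
    (c0.mul c2).intervalIntegrable_of_Icc hL
  have hF := intervalIntegral.integral_eq_sub_of_hasDerivAt_of_le hL (c0.mul c1)
    (fun x hx => (h.hasDerivAt_x ht hx).mul (h.hasDerivAt_xx ht hx)) (i1.add i2)
  rw [intervalIntegral.integral_add i1 i2] at hF
  have hpos : 0 ≤ ∫ x in (0 : ℝ)..L, φx t x * φx t x :=
    intervalIntegral.integral_nonneg hL fun x _ => mul_self_nonneg _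
  simp only [Pi.mul_apply, h.bc0 t ht.le, h.bcL t ht.le] at hF
  linarith

theorem continuousOn_energy (h : IsDirichletHeatSol L φ φt φx φxx) (hL : 0 ≤ L) :
    ContinuousOn (fun t => ∫ x in (0 : ℝ)..L, φ t x ^ 2) (Set.Ici 0) := by
  have hc : Continuous fun p : ℝ × ℝ => φ (max p.1 0) (Set.projIcc 0 L hL p.2) ^ 2 :=
    (h.cont.comp_continuous (f := fun p : ℝ × ℝ => (max p.1 0, (Set.projIcc 0 L hL p.2 : ℝ)))
      (by fun_prop) fun p =>
        Set.mk_mem_prod (le_max_right p.1 0) (Subtype.prop _)).pow 2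
  refine (intervalIntegral.continuous_parametric_intervalIntegral_of_continuous'
    (μ := volume)
    (f := fun t x => φ (max t 0) (Set.projIcc 0 L hL x) ^ 2) hc 0 L).continuousOn.congr fun t ht => ?_
  refine intervalIntegral.integral_congr fun x hx => ?_
  rw [Set.uIcc_of_le hL] at hx
  simp only [max_eq_left (Set.mem_Ici.1 ht), Set.projIcc_of_mem hL hx]

theorem hasDerivWithinAt_energy (h : IsDirichletHeatSol L φ φt φx φxx) (hL : 0 ≤ L) {s : ℝ}
    (hs : 0 < s) :
    HasDerivWithinAt (fun t => ∫ x in (0 : ℝ)..L, φ t x ^ 2)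
      (2 * ∫ x in (0 : ℝ)..L, φ s x * φxx s x) (Set.Ici s) s := by
  obtain ⟨K, hK⟩ := h.exists_abs_sub_le hs
  have hint : ∀ {t : ℝ}, 0 ≤ t → IntervalIntegrable (fun x => φ t x ^ 2) volume 0 L := fun ht =>
    ((h.continuousOn_slice ht).pow 2).intervalIntegrable_of_Icc hL
  rw [← hasDerivWithinAt_Ioi_iff_Ici, hasDerivWithinAt_iff_tendsto_slope' (by simp),
    ← intervalIntegral.integral_const_mul]
  obtain ⟨B, hB⟩ := isCompact_Icc.exists_bound_of_continuousOn (h.continuousOn_slice hs.le)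
  have hlim : Filter.Tendsto
      (fun t => ∫ x in (0 : ℝ)..L, (φ t x ^ 2 - φ s x ^ 2) / (t - s)) (nhdsWithin s (Set.Ioi s))
      (nhds (∫ x in (0 : ℝ)..L, 2 * (φ s x * φxx s x))) := by
    refine intervalIntegral.tendsto_integral_filter_of_dominated_convergence
      (fun _ => (2 * B + K) * K) ?_ ?_ (by simp) ?_
    · filter_upwards [self_mem_nhdsWithin] with t ht
      have ht0 : 0 ≤ t := hs.le.trans (le_of_lt ht)
      exact (((hint ht0).sub (hint hs.le)).div_const _).def'.aestronglyMeasurable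
    · filter_upwards [Ioo_mem_nhdsGT (lt_add_one s)] with t ht
      refine Filter.Eventually.of_forall fun x hx => ?_
      rw [Set.uIoc_of_le hL] at hx
      have hx' := Set.Ioc_subset_Icc_self hx
      have h1 := hK t ht.1.le x hx'
      have h2 := hB x hx'
      have hts : 0 < t - s := sub_pos.2 ht.1
      have hK0 : 0 ≤ K := nonneg_of_mul_nonneg_left ((abs_nonneg _).trans h1) hts
      rw [Real.norm_eq_abs] at h2 ⊢
      rw [abs_div, abs_of_pos hts, div_le_iff₀ hts, sq_sub_sq, abs_mul]
      have h3 : |φ t x + φ s x| ≤ 2 * B + K := by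
        calc |φ t x + φ s x| = |(φ t x - φ s x) + φ s x + φ s x| := by ring_nf
          _ ≤ |φ t x - φ s x| + |φ s x| + |φ s x| := abs_add_three _ _ _
          _ ≤ 2 * B + K := by nlinarith [ht.2]
      calc _ ≤ (2 * B + K) * (K * (t - s)) :=
            mul_le_mul h3 h1 (abs_nonneg _) ((abs_nonneg _).trans h3)
        _ = _ := by ring
    · refine Filter.Eventually.of_forall fun x hx => ?_
      rw [Set.uIoc_of_le hL] at hx
      have hd := (h.ht s hs x (Set.Ioc_subset_Icc_self hx)).pow 2
      have hval : 2 * (φ s x * φxx s x) = ↑2 * φ s x ^ (2 - 1) * φt s x := by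
        rcases hx.2.lt_or_eq with hlt | rfl
        · rw [h.pde s hs x ⟨hx.1, hlt⟩]; norm_num; ring
        · simp [h.bcL s hs.le]
      have hd' := (hasDerivWithinAt_iff_tendsto_slope' (s := Set.Ioi s) (by simp)).1
        hd.hasDerivWithinAt
      rw [hval]
      exact hd'.congr fun t => by simp [slope_def_field]
  refine hlim.congr' ?_
  filter_upwards [self_mem_nhdsWithin] with t ht
  rw [slope_def_field, intervalIntegral.integral_div,
    intervalIntegral.integral_sub (hint (hs.le.trans (le_of_lt ht))) (hint hs.le)]

theorem energy_antitone (h : IsDirichletHeatSol L φ φt φx φxx) (hL : 0 ≤ L) {s t : ℝ}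
    (hs : 0 < s) (hst : s ≤ t) :
    ∫ x in (0 : ℝ)..L, φ t x ^ 2 ≤ ∫ x in (0 : ℝ)..L, φ s x ^ 2 :=
  image_le_of_deriv_right_le_deriv_boundary
    (f := fun t => ∫ x in (0 : ℝ)..L, φ t x ^ 2)
    ((h.continuousOn_energy hL).mono fun _ hτ => hs.le.trans hτ.1)
    (fun _ hτ => h.hasDerivWithinAt_energy hL (hs.trans_le hτ.1)) le_rfl
    continuousOn_const (fun _ _ => hasDerivWithinAt_const _ _ _)
    (fun _ hτ => mul_nonpos_of_nonneg_of_nonpos zero_le_two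
      (h.integral_mul_xx_nonpos hL (hs.trans_le hτ.1))) ⟨hst, le_rfl⟩

/-- The weighted space-time integral of a heat solution controls its energy at time `b`. -/
theorem energy_le_weighted_integral (h : IsDirichletHeatSol L φ φt φx φxx) (hL : 0 ≤ L)
    {a b : ℝ} (ha : 0 < a) (hab : a ≤ b)
    (hint : IntegrableOn
      (fun t => ∫ x in (0 : ℝ)..L, Real.exp (-L ^ 2 / (2 * t)) * (φ t x) ^ 2) (Set.Ioi 0)) :
    (b - a) * (Real.exp (-L ^ 2 / (2 * a)) * ∫ x in (0 : ℝ)..L, φ b x ^ 2) ≤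
      ∫ t in Set.Ioi (0 : ℝ), ∫ x in (0 : ℝ)..L, Real.exp (-L ^ 2 / (2 * t)) * (φ t x) ^ 2 := by
  have hsub : Set.Ioc a b ⊆ Set.Ioi 0 := fun t ht => ha.trans ht.1
  calc _ = ∫ _ in Set.Ioc a b, Real.exp (-L ^ 2 / (2 * a)) * ∫ x in (0 : ℝ)..L, φ b x ^ 2 := by
        simp [hab]
    _ ≤ ∫ t in Set.Ioc a b, ∫ x in (0 : ℝ)..L, Real.exp (-L ^ 2 / (2 * t)) * (φ t x) ^ 2 := by
        refine setIntegral_mono_on (integrableOn_const (by simp)) (hint.mono_set hsub) measurableSet_Ioc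
          fun t ht => ?_
        rw [intervalIntegral.integral_const_mul]
        refine mul_le_mul (Real.exp_le_exp.2 ?_) (h.energy_antitone hL (ha.trans ht.1) ht.2)
          (intervalIntegral.integral_nonneg hL fun x _ => sq_nonneg _) (Real.exp_nonneg _)
        rw [neg_div, neg_div, neg_le_neg_iff]
        have := ht.1.le
        gcongr
    _ ≤ _ := by
        refine setIntegral_mono_set hint ?_ (Filter.Eventually.of_forall hsub)
        exact Filter.Eventually.of_forall fun t =>
          intervalIntegral.integral_nonneg hL fun x _ => by positivity

end IsDirichletHeatSol

namespace IsAdjointTDSol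

variable {L M ε : ℝ} {ψ ψt ψx ψxx : ℝ → ℝ → ℝ}

/-- Rescaling time and removing the drift by an exponential weight yields a heat solution. -/
theorem toHeatSol (h : IsAdjointTDSol L M ε ψ ψt ψx ψxx) (hε : 0 < ε) :
    IsDirichletHeatSol L
      (fun t x => Real.exp (M ^ 2 * t / (4 * ε ^ 2) + M * x / (2 * ε)) * ψ (t / ε) x)
      (fun t x => Real.exp (M ^ 2 * t / (4 * ε ^ 2) + M * x / (2 * ε)) *
        (M ^ 2 / (4 * ε ^ 2) * ψ (t / ε) x + ψt (t / ε) x / ε))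
      (fun t x => Real.exp (M ^ 2 * t / (4 * ε ^ 2) + M * x / (2 * ε)) *
        (M / (2 * ε) * ψ (t / ε) x + ψx (t / ε) x))
      (fun t x => Real.exp (M ^ 2 * t / (4 * ε ^ 2) + M * x / (2 * ε)) *
        (M / (2 * ε) * (M / (2 * ε) * ψ (t / ε) x + ψx (t / ε) x) +
          (M / (2 * ε) * ψx (t / ε) x + ψxx (t / ε) x))) := by
  have hpos : ∀ {t : ℝ}, 0 < t → 0 < t / ε := fun ht => div_pos ht hε
  have hexp : ∀ t x : ℝ, HasDerivAt
      (fun ξ => Real.exp (M ^ 2 * t / (4 * ε ^ 2) + M * ξ / (2 * ε)))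
      (Real.exp (M ^ 2 * t / (4 * ε ^ 2) + M * x / (2 * ε)) * (M / (2 * ε))) x := fun t x => by
    simpa using ((((hasDerivAt_id x).const_mul M).div_const (2 * ε)).const_add
      (M ^ 2 * t / (4 * ε ^ 2))).exp
  have hψ : ∀ t > 0, ContinuousOn (fun x => ψ (t / ε) x) (Set.Icc 0 L) := fun t ht x hx =>
    (h.hx (t / ε) (hpos ht) x hx).continuousWithinAt
  have hexpc : ∀ t : ℝ, Continuous
      (fun x => Real.exp (M ^ 2 * t / (4 * ε ^ 2) + M * x / (2 * ε))) := fun t => by fun_prop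
  refine ⟨?_, ?_, ?_, ?_, ?_, ?_, ?_, ?_, ?_, ?_⟩
  · refine ContinuousOn.mul (by fun_prop) (h.cont.comp (f := fun p : ℝ × ℝ => (p.1 / ε, p.2))
      (by fun_prop) fun p hp => ⟨?_, hp.2⟩)
    exact div_nonneg hp.1 hε.le
  · intro t ht x hx
    have h1 : HasDerivAt (fun τ => Real.exp (M ^ 2 * τ / (4 * ε ^ 2) + M * x / (2 * ε)))
        (Real.exp (M ^ 2 * t / (4 * ε ^ 2) + M * x / (2 * ε)) * (M ^ 2 / (4 * ε ^ 2))) t := by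
      simpa using ((((hasDerivAt_id t).const_mul (M ^ 2)).div_const (4 * ε ^ 2)).add_const
        (M * x / (2 * ε))).exp
    have h2 : HasDerivAt (fun τ => ψ (τ / ε) x) (ψt (t / ε) x * (1 / ε)) t :=
      (h.ht (t / ε) (hpos ht) x hx).comp (h := fun τ => τ / ε) t ((hasDerivAt_id t).div_const ε)
    exact (h1.mul h2).congr_deriv (by ring)
  · intro x hx t ht
    have h1 : ContinuousAt (fun τ => ψ (τ / ε) x) t :=
      (h.ht (t / ε) (hpos ht) x hx).continuousAt.comp (f := fun τ : ℝ => τ / ε) (by fun_prop)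
    have h2 : ContinuousAt (fun τ => ψt (τ / ε) x) t :=
      ((h.htc x hx).continuousAt (Ioi_mem_nhds (hpos ht))).comp (f := fun τ : ℝ => τ / ε)
        (by fun_prop)
    exact (ContinuousAt.mul (by fun_prop)
      ((h1.const_mul _).add (h2.div_const _))).continuousWithinAt
  · intro t ht x hx
    exact ((hexp t x).hasDerivWithinAt.mul (h.hx (t / ε) (hpos ht) x hx)).congr_deriv (by ring)
  · intro t ht
    exact (hexpc t).continuousOn.mul (((hψ t ht).const_mul _).add (h.hxc _ (hpos ht)))
  · intro t ht x hx
    exact ((hexp t x).hasDerivWithinAt.mul (((h.hx (t / ε) (hpos ht) x hx).const_mul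
      (M / (2 * ε))).add (h.hxx (t / ε) (hpos ht) x hx))).congr_deriv
        (by rw [Pi.add_apply]; ring)
  · intro t ht
    exact (hexpc t).continuousOn.mul (((((hψ t ht).const_mul _).add
      (h.hxc _ (hpos ht))).const_mul _).add (((h.hxc _ (hpos ht)).const_mul _).add
        (h.hxxc _ (hpos ht))))
  · intro t ht x hx
    have hp := h.pde (t / ε) (hpos ht) x hx
    have hp' : ψt (t / ε) x = ε * ψxx (t / ε) x + M * ψx (t / ε) x := by linarith
    simp only [hp']
    field_simp
    ring
  · intro t ht
    simp only [h.bc0 (t / ε) (div_nonneg ht hε.le), mul_zero]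
  · intro t ht
    simp only [h.bcL (t / ε) (div_nonneg ht hε.le), mul_zero]

theorem continuousOn_slice (h : IsAdjointTDSol L M ε ψ ψt ψx ψxx) {t : ℝ} (ht : 0 ≤ t) :
    ContinuousOn (ψ t) (Set.Icc 0 L) :=
  h.cont.comp (f := fun x => (t, x)) (by fun_prop) fun _ hx => ⟨ht, hx⟩

end IsAdjointTDSol

/-- For nonpositive drift, the weighted energy bounds the plain one from above. -/
theorem exp_mul_integral_sq_le {L M ε A : ℝ} {f : ℝ → ℝ} (hL : 0 ≤ L) (hM : M ≤ 0) (hε : 0 < ε)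
    (hf : ContinuousOn f (Set.Icc 0 L)) :
    Real.exp (2 * A + M * L / ε) * ∫ x in (0 : ℝ)..L, f x ^ 2 ≤
      ∫ x in (0 : ℝ)..L, (Real.exp (A + M * x / (2 * ε)) * f x) ^ 2 := by
  rw [← intervalIntegral.integral_const_mul]
  refine intervalIntegral.integral_mono_on hL ?_ ?_ fun x hx => ?_
  · exact ((hf.pow 2).const_mul _).intervalIntegrable_of_Icc hL
  · exact ((ContinuousOn.mul (by fun_prop) hf).pow 2).intervalIntegrable_of_Icc hL
  · rw [mul_pow, ← Real.exp_nat_mul]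
    refine mul_le_mul_of_nonneg_right (Real.exp_le_exp.2 ?_) (sq_nonneg _)
    have h1 : M * L / ε ≤ M * x / ε := by
      gcongr ?_ / ε
      exact mul_le_mul_of_nonpos_left hx.2 hM
    have h2 : M * x / ε = 2 * (M * x / (2 * ε)) := by field_simp
    push_cast
    linarith

/-- Time rescaling of the weighted boundary observation. -/
theorem integral_exp_mul_sq_le {c ε s S T : ℝ} {g : ℝ → ℝ} (hc : 0 ≤ c) (hε : 0 < ε)
    (hS : 0 ≤ S) (hSs : S ≤ ε * s) (hsT : s ≤ T)
    (hw : IntervalIntegrable (fun t => (Real.exp (c * t) * g (t / ε)) ^ 2) volume 0 S)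
    (hg : IntervalIntegrable (fun t => g t ^ 2) volume 0 T) :
    ∫ t in (0 : ℝ)..S, (Real.exp (c * t) * g (t / ε)) ^ 2 ≤
      ε * Real.exp (2 * c * (ε * s)) * ∫ t in (0 : ℝ)..T, g t ^ 2 := by
  have hST : S / ε ≤ T := ((div_le_iff₀' hε).2 hSs).trans hsT
  have hS0 : 0 ≤ S / ε := div_nonneg hS hε.le
  have hg' : IntervalIntegrable (fun t => g t ^ 2) volume 0 (S / ε) :=
    hg.mono_set (by rw [Set.uIcc_of_le hS0, Set.uIcc_of_le (hS0.trans hST)]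
                    exact Set.Icc_subset_Icc_right hST)
  have hgs : IntervalIntegrable (fun t => g (t / ε) ^ 2) volume 0 S := by
    have := IntervalIntegrable.comp_mul_right hg' (c := ε⁻¹)
    simpa [div_eq_mul_inv, hε.ne'] using this
  calc ∫ t in (0 : ℝ)..S, (Real.exp (c * t) * g (t / ε)) ^ 2
      ≤ ∫ t in (0 : ℝ)..S, Real.exp (2 * c * (ε * s)) * g (t / ε) ^ 2 := by
        refine intervalIntegral.integral_mono_on hS hw (hgs.const_mul _) fun t ht => ?_
        rw [mul_pow, ← Real.exp_nat_mul]
        refine mul_le_mul_of_nonneg_right (Real.exp_le_exp.2 ?_) (sq_nonneg _)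
        have := mul_le_mul_of_nonneg_left (ht.2.trans hSs) hc
        push_cast
        linarith
    _ = ε * Real.exp (2 * c * (ε * s)) * ∫ t in (0 : ℝ)..S / ε, g t ^ 2 := by
        rw [intervalIntegral.integral_const_mul,
          intervalIntegral.integral_comp_div (fun t => g t ^ 2) hε.ne', zero_div, smul_eq_mul]
        ring
    _ ≤ _ := by
        refine mul_le_mul_of_nonneg_left ?_ (by positivity)
        exact intervalIntegral.integral_mono_interval le_rfl hS0 hST
          (Filter.Eventually.of_forall fun t => sq_nonneg _) hg

theorem discriminant_pos {L M T : ℝ} (hL : 0 < L) (hM : M < 0)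
    (hT : (1 + Real.sqrt 2) * L / |M| < T) : 0 < M ^ 2 * T + 2 * M * L - L ^ 2 / T := by
  have hm : 0 < |M| := abs_pos.2 hM.ne
  have hT0 : 0 < T := lt_of_le_of_lt (by positivity) hT
  rw [div_lt_iff₀ hm, abs_of_neg hM] at hT
  have h2 : Real.sqrt 2 ^ 2 = 2 := Real.sq_sqrt zero_le_two
  have h3 : 0 ≤ Real.sqrt 2 * L := by positivity
  have h4 : (Real.sqrt 2 * L) ^ 2 < (-(M * T) - L) ^ 2 := by
    gcongr
    linarith
  have h5 : M ^ 2 * T + 2 * M * L - L ^ 2 / T = ((-(M * T) - L) ^ 2 - (Real.sqrt 2 * L) ^ 2) / T := by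
    rw [mul_pow, h2]
    field_simp
    ring
  rw [h5]
  exact div_pos (sub_pos.2 h4) hT0

/-- Theorem 1 of the paper, case `M < 0`, `T > (1+√2)L/|M|`.  Assume
hypothesis (H) (Conjecture 2): for every `δ > 0` there are `C_δ, T_δ > 0` such that
every Dirichlet heat solution `φ` (with finite integrals) satisfies, for `S ∈ (0,T_δ)`,
`∫_0^∞∫_0^L e^{-L²/(2t)} φ² ≤ C_δ e^{δ/S} ∫_0^S (∂_x φ(t,0))²`.  Then there exist
`C, K > 0`, independent of `ε`, such that for every `ε ∈ (0,1)` and every adjoint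
transport-diffusion solution `ψ` (with all integrals finite)
`∫_0^L ψ(T,x)² dx ≤ C e^{-2K/ε} ∫_0^T (∂_x ψ(t,0))² dt`. -/
theorem uniform_controllability_neg_speed
    (L M T : ℝ) (hL : 0 < L) (hM : M < 0) (hT : (1 + Real.sqrt 2) * L / |M| < T)
    (H : ∀ δ > (0 : ℝ), ∃ Cδ > (0 : ℝ), ∃ Tδ > (0 : ℝ),
      ∀ S ∈ Set.Ioo (0 : ℝ) Tδ, ∀ φ φt φx φxx : ℝ → ℝ → ℝ,
        IsDirichletHeatSol L φ φt φx φxx →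
        IntegrableOn
          (fun t => ∫ x in (0 : ℝ)..L, Real.exp (-L ^ 2 / (2 * t)) * (φ t x) ^ 2)
          (Set.Ioi 0) →
        IntervalIntegrable (fun t => (φx t 0) ^ 2) volume 0 S →
        (∫ t in Set.Ioi (0 : ℝ),
            ∫ x in (0 : ℝ)..L, Real.exp (-L ^ 2 / (2 * t)) * (φ t x) ^ 2) ≤
          Cδ * Real.exp (δ / S) * ∫ t in (0 : ℝ)..S, (φx t 0) ^ 2) :
    ∃ C > (0 : ℝ), ∃ K > (0 : ℝ), ∀ ε ∈ Set.Ioo (0 : ℝ) 1,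
      ∀ ψ ψt ψx ψxx : ℝ → ℝ → ℝ,
        IsAdjointTDSol L M ε ψ ψt ψx ψxx →
        IntegrableOn
          (fun t => ∫ x in (0 : ℝ)..L, Real.exp (-L ^ 2 / (2 * t)) *
            (Real.exp (M ^ 2 * t / (4 * ε ^ 2) + M * x / (2 * ε)) * ψ (t / ε) x) ^ 2)
          (Set.Ioi 0) →
        (∀ S ∈ Set.Ioc (0 : ℝ) (ε * T), IntervalIntegrable
          (fun t => (Real.exp (M ^ 2 * t / (4 * ε ^ 2)) * ψx (t / ε) 0) ^ 2)
          volume 0 S) →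
        IntervalIntegrable (fun t => (ψx t 0) ^ 2) volume 0 T →
        (∫ x in (0 : ℝ)..L, (ψ T x) ^ 2) ≤
          C * Real.exp (-2 * K / ε) * ∫ t in (0 : ℝ)..T, (ψx t 0) ^ 2 := by
  have hT0 : 0 < T := lt_of_le_of_lt (by positivity) hT
  set D := M ^ 2 * T + 2 * M * L - L ^ 2 / T with hD
  have hD0 : 0 < D := discriminant_pos hL hM hT
  have hM2 : 0 < M ^ 2 := sq_pos_of_neg hM
  obtain ⟨T', hT'0, hT'T, hT'⟩ : ∃ T' > 0, T' < T ∧ L ^ 2 / T' = L ^ 2 / T + D / 4 := by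
    have h1 : 0 < L ^ 2 / T := by positivity
    refine ⟨L ^ 2 / (L ^ 2 / T + D / 4), by positivity, ?_, by field_simp⟩
    rw [div_lt_iff₀ (by positivity), mul_add, mul_div_cancel₀ _ hT0.ne']
    have : 0 < T * (D / 4) := by positivity
    linarith
  obtain ⟨s, hs0, hsT, hsD⟩ : ∃ s > 0, s ≤ T ∧ M ^ 2 * s ≤ D / 4 := by
    refine ⟨min T (D / 4 / M ^ 2), lt_min hT0 (by positivity), min_le_left _ _, ?_⟩
    calc M ^ 2 * min T (D / 4 / M ^ 2) ≤ M ^ 2 * (D / 4 / M ^ 2) := by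
          gcongr
          exact min_le_right _ _
      _ = D / 4 := mul_div_cancel₀ _ hM2.ne'
  obtain ⟨Cδ, hCδ, Tδ, hTδ, hH⟩ := H (s * D / 8) (by positivity)
  refine ⟨Cδ * Real.exp (s * D / 8 * (2 / Tδ)) / (T - T'),
    div_pos (by positivity) (sub_pos.2 hT'T), D / 16, by positivity, ?_⟩
  rintro ε ⟨hε, -⟩ ψ ψt ψx ψxx hψ hint hintS hintT
  have hφ := hψ.toHeatSol hε
  obtain ⟨S, hS0, hSTδ, hSs, hSinv⟩ :
      ∃ S > 0, S < Tδ ∧ S ≤ ε * s ∧ 1 / S ≤ 1 / (ε * s) + 2 / Tδ := by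
    refine ⟨min (ε * s) (Tδ / 2), lt_min (by positivity) (by positivity),
      (min_le_right _ _).trans_lt (half_lt_self hTδ), min_le_left _ _, ?_⟩
    have h1 : 0 < 1 / (ε * s) := by positivity
    have h2 : 0 < 2 / Tδ := by positivity
    rcases min_choice (ε * s) (Tδ / 2) with h | h <;> rw [h]
    · linarith
    · rw [one_div_div]; linarith
  have hbdry : ∀ t ∈ Set.Icc 0 S,
      (Real.exp (M ^ 2 * t / (4 * ε ^ 2) + M * 0 / (2 * ε)) *
        (M / (2 * ε) * ψ (t / ε) 0 + ψx (t / ε) 0)) ^ 2 =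
      (Real.exp (M ^ 2 * t / (4 * ε ^ 2)) * ψx (t / ε) 0) ^ 2 := fun t ht => by
    rw [hψ.bc0 (t / ε) (div_nonneg ht.1 hε.le)]
    simp
  have hS := hintS S ⟨hS0, hSs.trans (by gcongr)⟩
  have hobs := hH S ⟨hS0, hSTδ⟩ _ _ _ _ hφ hint (hS.congr fun t ht => by
    rw [Set.uIoc_of_le hS0.le] at ht
    exact (hbdry t (Set.Ioc_subset_Icc_self ht)).symm)
  rw [intervalIntegral.integral_congr (g := fun t =>
    (Real.exp (M ^ 2 * t / (4 * ε ^ 2)) * ψx (t / ε) 0) ^ 2) (fun t ht => by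
      rw [Set.uIcc_of_le hS0.le] at ht
      exact hbdry t ht)] at hobs
  have hlow := hφ.energy_le_weighted_integral hL.le (a := ε * T') (b := ε * T) (by positivity)
    (by gcongr) hint
  have hE := exp_mul_integral_sq_le (A := M ^ 2 * (ε * T) / (4 * ε ^ 2)) hL.le hM.le hε
    (hψ.continuousOn_slice hT0.le)
  rw [mul_div_cancel_left₀ T hε.ne'] at hlow
  have hc : ∀ t : ℝ, M ^ 2 * t / (4 * ε ^ 2) = M ^ 2 / (4 * ε ^ 2) * t := fun t => by ring
  have hup := integral_exp_mul_sq_le (c := M ^ 2 / (4 * ε ^ 2)) (g := fun t => ψx t 0)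
    (by positivity) hε hS0.le hSs hsT (by simpa only [hc] using hS) hintT
  simp only [← hc] at hup
  set E := ∫ x in (0 : ℝ)..L, (ψ T x) ^ 2
  set O := ∫ t in (0 : ℝ)..T, (ψx t 0) ^ 2
  have hO : 0 ≤ O := intervalIntegral.integral_nonneg hT0.le fun _ _ => sq_nonneg _
  have hη : 0 < T - T' := sub_pos.2 hT'T
  set p := -L ^ 2 / (2 * (ε * T')) with hp
  set q := 2 * (M ^ 2 * (ε * T) / (4 * ε ^ 2)) + M * L / ε with hq
  set r := 2 * (M ^ 2 / (4 * ε ^ 2)) * (ε * s) with hr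
  clear_value p q r
  have hchain : (ε * T - ε * T') * (Real.exp p * (Real.exp q * E)) ≤
      Cδ * Real.exp (s * D / 8 / S) * (ε * Real.exp r * O) := by
    have h1 : 0 ≤ ε * T - ε * T' := by nlinarith
    calc _ ≤ _ := by gcongr
      _ ≤ _ := hlow
      _ ≤ _ := hobs
      _ ≤ _ := mul_le_mul_of_nonneg_left hup (by positivity)
  have hexp : s * D / 8 / S + r - p - q ≤ s * D / 8 * (2 / Tδ) + -2 * (D / 16) / ε := by
    have h1 : s * D / 8 / S ≤ s * D / 8 * (1 / (ε * s) + 2 / Tδ) := by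
      rw [div_eq_mul_one_div (s * D / 8) S]
      gcongr
    have h2 : s * D / 8 * (1 / (ε * s)) = D / 4 / (2 * ε) := by field_simp; norm_num
    have h3 : r = M ^ 2 * s / (2 * ε) := by rw [hr]; field_simp; ring
    have h4 : p = -(L ^ 2 / T') / (2 * ε) := by rw [hp]; field_simp
    have h5 : q = (M ^ 2 * T + 2 * M * L) / (2 * ε) := by rw [hq]; field_simp; ring
    have h6 : D / 4 / (2 * ε) + r - p - q =
        (D / 4 + M ^ 2 * s + L ^ 2 / T' - (M ^ 2 * T + 2 * M * L)) / (2 * ε) := by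
      rw [h3, h4, h5]; ring
    have h7 : (D / 4 + M ^ 2 * s + L ^ 2 / T' - (M ^ 2 * T + 2 * M * L)) / (2 * ε) ≤
        (-(D / 4)) / (2 * ε) := by
      gcongr
      rw [hT']
      linarith
    have h8 : (-(D / 4)) / (2 * ε) = -2 * (D / 16) / ε := by field_simp; norm_num
    rw [mul_add] at h1
    linarith
  have hmain : (T - T') * E ≤ Cδ * Real.exp (s * D / 8 / S + r - p - q) * O := by
    have h1 : 0 < ε * (Real.exp p * Real.exp q) := by positivity
    refine le_of_mul_le_mul_left ?_ h1
    generalize s * D / 8 / S = u at hchain ⊢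
    rw [Real.exp_sub, Real.exp_sub, Real.exp_add]
    calc _ = (ε * T - ε * T') * (Real.exp p * (Real.exp q * E)) := by ring
      _ ≤ _ := hchain
      _ = _ := by field_simp
  calc E ≤ Cδ * Real.exp (s * D / 8 / S + r - p - q) * O / (T - T') := by
        rwa [le_div_iff₀' hη]
    _ ≤ Cδ * Real.exp (s * D / 8 * (2 / Tδ) + -2 * (D / 16) / ε) * O / (T - T') := by
        gcongr
    _ = _ := by rw [Real.exp_add]; ring
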